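/- arXiv:2307.12535 — 4 statements merged into one kernel-verified Lean document; each statement's English description precedes it below -/
import Mathlib

section
/- For every N, every β > 0, h > 0 and every realization of the disorder, the identity ⟨(R − ⟨R⟩)²⟩ = N^{−2} tr(MᵀM) + 2N^{−2}(m, M m) holds, and consequently N^{−2}‖M‖_op² ≤ ⟨(R − ⟨R⟩)²⟩ ≤ N^{−1}(‖M‖_op² + 2‖M‖_op). -/
open MeasureTheory ProbabilityTheory Real Filter

noncomputable section

namespace SK

/-- The spin value `±1` encoded by a Boolean. -/
def spin (b : Bool) : ℝ := if b then 1 else -1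

/-- SK Hamiltonian with coupling matrix `g`, inverse temperature `β` and external
field vector `hv`:  `H(σ) = β ∑_{i<j} g_{ij} σ_i σ_j + ∑_i hv_i σ_i`. -/
def hamiltonian (N : ℕ) (β : ℝ) (g : Fin N → Fin N → ℝ) (hv : Fin N → ℝ)
    (σ : Fin N → ℝ) : ℝ :=
  β * ∑ i : Fin N, ∑ j : Fin N, (if i < j then g i j * σ i * σ j else 0)
    + ∑ i : Fin N, hv i * σ i

/-- Partition function `Z_N`. -/
def partitionZ (N : ℕ) (β : ℝ) (g : Fin N → Fin N → ℝ) (hv : Fin N → ℝ) : ℝ :=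
  ∑ s : Fin N → Bool, Real.exp (hamiltonian N β g hv (fun i => spin (s i)))

/-- Gibbs expectation `⟨f⟩`. -/
def gibbs (N : ℕ) (β : ℝ) (g : Fin N → Fin N → ℝ) (hv : Fin N → ℝ)
    (f : (Fin N → ℝ) → ℝ) : ℝ :=
  (∑ s : Fin N → Bool, f (fun i => spin (s i)) *
      Real.exp (hamiltonian N β g hv (fun i => spin (s i)))) / partitionZ N β g hv

/-- Magnetization `m_i = ⟨σ_i⟩`. -/
def mag (N : ℕ) (β : ℝ) (g : Fin N → Fin N → ℝ) (hv : Fin N → ℝ) (i : Fin N) : ℝ :=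
  gibbs N β g hv (fun σ => σ i)

/-- Two point correlation `m_{ij} = ⟨σ_i σ_j⟩ - ⟨σ_i⟩⟨σ_j⟩`. -/
def corr (N : ℕ) (β : ℝ) (g : Fin N → Fin N → ℝ) (hv : Fin N → ℝ) (i j : Fin N) : ℝ :=
  gibbs N β g hv (fun σ => σ i * σ j) - mag N β g hv i * mag N β g hv j

/-- Operator (ℓ²→ℓ²) norm of an `N×N` real matrix. -/
def opNorm (N : ℕ) (A : Fin N → Fin N → ℝ) : ℝ :=
  sSup {x : ℝ | ∃ u : Fin N → ℝ, (∑ i, u i ^ 2) = 1 ∧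
    x = Real.sqrt (∑ i, (∑ j, A i j * u j) ^ 2)}

/-- `q ↦ E tanh²(h + β √q Z)`, `Z` standard Gaussian. -/
def qtanh (β h q : ℝ) : ℝ :=
  ∫ z, Real.tanh (h + β * Real.sqrt q * z) ^ 2 ∂(gaussianReal 0 1)

/-- `q` is the (unique) solution in `(0,1)` of `q = E tanh²(h + β √q Z)`. -/
def isFixedq (β h q : ℝ) : Prop := 0 < q ∧ q < 1 ∧ q = qtanh β h q

/-- The de Almeida–Thouless condition `β² E sech⁴(h + β √q Z) < 1`. -/
def ATcond (β h q : ℝ) : Prop :=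
  β ^ 2 * ∫ z, (Real.cosh (h + β * Real.sqrt q * z))⁻¹ ^ 4 ∂(gaussianReal 0 1) < 1

/-- The functional `Φ(m, q')` from condition (AT+). -/
def Phi (β h q m q' : ℝ) : ℝ :=
  Real.log 2 + β ^ 2 / 4 * (1 - q') ^ 2 - β ^ 2 / 4 * m * (q' ^ 2 - q ^ 2)
    + (1 / m) * ∫ z, Real.log (∫ z', Real.cosh (h + β * Real.sqrt q * z
        + β * Real.sqrt (q' - q) * z') ^ m ∂(gaussianReal 0 1)) ∂(gaussianReal 0 1)

/-- Condition (AT+): `(∂_m Φ)(m, q')|_{m=1} < 0` for all `q < q' ≤ 1`. -/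
def ATplus (β h q : ℝ) : Prop :=
  ∀ q' : ℝ, q < q' → q' ≤ 1 → deriv (fun m => Phi β h q m q') 1 < 0

/-- `G` is a GOE random matrix: symmetric, zero diagonal, and the entries above the
diagonal are i.i.d. centered Gaussians of variance `1/N`. -/
def IsGOE (N : ℕ) {Ω : Type*} [MeasurableSpace Ω] (P : Measure Ω)
    (G : Ω → Fin N → Fin N → ℝ) : Prop :=
  (∀ ω i j, G ω i j = G ω j i) ∧ (∀ ω i, G ω i i = 0) ∧
  iIndepFun (m := fun _ : {p : Fin N × Fin N // p.1 < p.2} => (inferInstance : MeasurableSpace ℝ))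
    (fun p ω => G ω p.1.1 p.1.2) P ∧
  ∀ p : {p : Fin N × Fin N // p.1 < p.2},
    Measure.map (fun ω => G ω p.1.1 p.1.2) P = gaussianReal 0 (N : NNReal)⁻¹


/-- Gibbs expectation over two independent replicas. -/
def gibbs2 (N : ℕ) (β : ℝ) (g : Fin N → Fin N → ℝ) (hv : Fin N → ℝ)
    (f : (Fin N → ℝ) → (Fin N → ℝ) → ℝ) : ℝ :=
  (∑ s : Fin N → Bool, ∑ t : Fin N → Bool,
      f (fun i => spin (s i)) (fun i => spin (t i)) *
        Real.exp (hamiltonian N β g hv (fun i => spin (s i))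
          + hamiltonian N β g hv (fun i => spin (t i))))
    / (partitionZ N β g hv) ^ 2

/-- The overlap `R(σ,τ) = N⁻¹ (σ,τ)`. -/
def overlap (N : ℕ) (σ τ : Fin N → ℝ) : ℝ := (N : ℝ)⁻¹ * ∑ i, σ i * τ i

theorem opNorm_bdd (N : ℕ) (A : Fin N → Fin N → ℝ) (u : Fin N → ℝ) :
    (∑ i, (∑ j, A i j * u j) ^ 2) ≤ (∑ i, ∑ j, A i j ^ 2) * ∑ j, u j ^ 2 := by
  rw [Finset.sum_mul]
  exact Finset.sum_le_sum fun i _ => Finset.sum_mul_sq_le_sq_mul_sq _ _ _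

theorem opNorm_nonneg (N : ℕ) (A : Fin N → Fin N → ℝ) : 0 ≤ opNorm N A := by
  apply Real.sSup_nonneg
  rintro x ⟨u, _, rfl⟩
  exact Real.sqrt_nonneg _

theorem opNorm_sq_le (N : ℕ) (A : Fin N → Fin N → ℝ) :
    opNorm N A ^ 2 ≤ ∑ i, ∑ j, A i j ^ 2 := by
  have h0 : 0 ≤ ∑ i, ∑ j, A i j ^ 2 :=
    Finset.sum_nonneg fun i _ => Finset.sum_nonneg fun j _ => sq_nonneg _
  have h1 : opNorm N A ≤ Real.sqrt (∑ i, ∑ j, A i j ^ 2) := by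
    apply Real.sSup_le _ (Real.sqrt_nonneg _)
    rintro x ⟨u, hu, rfl⟩
    apply Real.sqrt_le_sqrt
    have := opNorm_bdd N A u
    rwa [hu, mul_one] at this
  calc opNorm N A ^ 2 ≤ Real.sqrt (∑ i, ∑ j, A i j ^ 2) ^ 2 :=
        pow_le_pow_left₀ (opNorm_nonneg N A) h1 2
    _ = _ := Real.sq_sqrt h0

theorem le_opNorm_unit (N : ℕ) (A : Fin N → Fin N → ℝ) (u : Fin N → ℝ)
    (hu : ∑ i, u i ^ 2 = 1) : Real.sqrt (∑ i, (∑ j, A i j * u j) ^ 2) ≤ opNorm N A := by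
  apply le_csSup
  · refine ⟨Real.sqrt (∑ i, ∑ j, A i j ^ 2), ?_⟩
    rintro x ⟨u, hu, rfl⟩
    apply Real.sqrt_le_sqrt
    have := opNorm_bdd N A u
    rwa [hu, mul_one] at this
  · exact ⟨u, hu, rfl⟩

theorem le_opNorm (N : ℕ) (A : Fin N → Fin N → ℝ) (v : Fin N → ℝ) :
    (∑ i, (∑ j, A i j * v j) ^ 2) ≤ opNorm N A ^ 2 * ∑ i, v i ^ 2 := by
  have h0 : 0 ≤ ∑ i, v i ^ 2 := Finset.sum_nonneg fun i _ => sq_nonneg _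
  rcases h0.eq_or_lt with h | h
  · have := opNorm_bdd N A v
    rw [← h] at this ⊢
    simpa using this
  · set r := Real.sqrt (∑ i, v i ^ 2) with hr
    have hr0 : 0 < r := Real.sqrt_pos.2 h
    have hr2 : r ^ 2 = ∑ i, v i ^ 2 := Real.sq_sqrt h0
    have h1 := le_opNorm_unit N A (fun i => v i / r) (by
      simp only [div_pow]
      rw [← Finset.sum_div, ← hr2]
      field_simp)
    have h2 : (∑ i, (∑ j, A i j * (v j / r)) ^ 2) = (∑ i, (∑ j, A i j * v j) ^ 2) / r ^ 2 := by
      rw [Finset.sum_div]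
      refine Finset.sum_congr rfl fun i _ => ?_
      rw [← div_pow, Finset.sum_div]
      congr 1
      exact Finset.sum_congr rfl fun j _ => by ring
    rw [h2, Real.sqrt_le_left (opNorm_nonneg N A), div_le_iff₀ (by positivity), hr2] at h1
    exact h1

/-- Abstract replica identity. -/
theorem abstract_identity {S : Type*} [Fintype S] (N : ℕ) (p : S → ℝ) (hp1 : ∑ s, p s = 1)
    (x : S → Fin N → ℝ) (m : Fin N → ℝ) (c : Fin N → Fin N → ℝ)
    (hm : ∀ i, m i = ∑ s, x s i * p s)
    (hc : ∀ i j, c i j = (∑ s, x s i * x s j * p s) - m i * m j) :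
    (∑ s, ∑ t, ((N : ℝ)⁻¹ * ∑ i, x s i * x t i
        - ∑ s, ∑ t, ((N : ℝ)⁻¹ * ∑ i, x s i * x t i) * (p s * p t)) ^ 2 * (p s * p t))
      = ((N : ℝ) ^ 2)⁻¹ * (∑ i, ∑ j, c i j ^ 2)
        + 2 * ((N : ℝ) ^ 2)⁻¹ * (∑ i, m i * ∑ j, c i j * m j) := by
  have hR : (∑ s, ∑ t, (∑ i, x s i * x t i) * (p s * p t)) = ∑ i, m i ^ 2 := by
    have : ∀ s t, (∑ i, x s i * x t i) * (p s * p t)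
        = ∑ i, (x s i * p s) * (x t i * p t) := fun s t => by
      rw [Finset.sum_mul]
      exact Finset.sum_congr rfl fun i _ => by ring
    simp only [this, hm, sq, Finset.sum_mul_sum]
    rw [Finset.sum_comm (s := (Finset.univ : Finset (Fin N)))]
    refine Finset.sum_congr rfl fun s _ => ?_
    rw [Finset.sum_comm]
  have hR2 : (∑ s, ∑ t, (∑ i, x s i * x t i) ^ 2 * (p s * p t))
      = ∑ i, ∑ j, (∑ s, x s i * x s j * p s) ^ 2 := by
    have : ∀ s t, (∑ i, x s i * x t i) ^ 2 * (p s * p t)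
        = ∑ i, ∑ j, (x s i * x s j * p s) * (x t i * x t j * p t) := fun s t => by
      rw [sq, Finset.sum_mul_sum, Finset.sum_mul]
      refine Finset.sum_congr rfl fun i _ => ?_
      rw [Finset.sum_mul]
      exact Finset.sum_congr rfl fun j _ => by ring
    simp only [this]
    simp only [sq, Finset.sum_mul_sum]
    calc _ = ∑ s, ∑ i, ∑ t, ∑ j, (x s i * x s j * p s) * (x t i * x t j * p t) :=
          Finset.sum_congr rfl fun s _ => Finset.sum_comm
      _ = ∑ i, ∑ s, ∑ t, ∑ j, (x s i * x s j * p s) * (x t i * x t j * p t) :=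
          Finset.sum_comm
      _ = ∑ i, ∑ s, ∑ j, ∑ t, (x s i * x s j * p s) * (x t i * x t j * p t) :=
          Finset.sum_congr rfl fun i _ => Finset.sum_congr rfl fun s _ => Finset.sum_comm
      _ = _ := Finset.sum_congr rfl fun i _ => Finset.sum_comm
  have h11 : (∑ s, ∑ t, p s * p t) = 1 := by
    rw [← Finset.sum_mul_sum, hp1, one_mul]
  have hRN : (∑ s, ∑ t, ((N : ℝ)⁻¹ * ∑ i, x s i * x t i) * (p s * p t))
      = (N : ℝ)⁻¹ * ∑ i, m i ^ 2 := by
    rw [← hR]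
    rw [Finset.mul_sum]
    refine Finset.sum_congr rfl fun s _ => ?_
    rw [Finset.mul_sum]
    exact Finset.sum_congr rfl fun t _ => by ring
  rw [hRN]
  set Q := ∑ i, m i ^ 2 with hQ
  have e1 : (∑ s, ∑ t, ((N : ℝ)⁻¹ * ∑ i, x s i * x t i - (N : ℝ)⁻¹ * Q) ^ 2 * (p s * p t))
      = ((N : ℝ) ^ 2)⁻¹ * ((∑ s, ∑ t, (∑ i, x s i * x t i) ^ 2 * (p s * p t))
        - 2 * Q * (∑ s, ∑ t, (∑ i, x s i * x t i) * (p s * p t))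
        + Q ^ 2 * (∑ s, ∑ t, p s * p t)) := by
    have gen : ∀ r : S → S → ℝ,
        (∑ s, ∑ t, ((N : ℝ)⁻¹ * r s t - (N : ℝ)⁻¹ * Q) ^ 2 * (p s * p t))
        = ((N : ℝ) ^ 2)⁻¹ * ((∑ s, ∑ t, r s t ^ 2 * (p s * p t))
          - 2 * Q * (∑ s, ∑ t, r s t * (p s * p t))
          + Q ^ 2 * (∑ s, ∑ t, p s * p t)) := fun r => by
      clear_value Q
      simp only [Finset.mul_sum, ← Finset.sum_add_distrib, ← Finset.sum_sub_distrib]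
      refine Finset.sum_congr rfl fun s _ => Finset.sum_congr rfl fun t _ => ?_
      ring
    exact gen fun s t => ∑ i, x s i * x t i
  rw [e1, hR, hR2, h11]
  have e2 : (∑ i, ∑ j, (∑ s, x s i * x s j * p s) ^ 2)
      = (∑ i, ∑ j, c i j ^ 2) + 2 * (∑ i, m i * ∑ j, c i j * m j) + Q * Q := by
    rw [hQ, Finset.sum_mul_sum]
    simp only [Finset.mul_sum, ← Finset.sum_add_distrib]
    refine Finset.sum_congr rfl fun i _ => Finset.sum_congr rfl fun j _ => ?_
    rw [hc]
    ring
  rw [e2]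
  ring

theorem abstract_psd {S : Type*} [Fintype S] (N : ℕ) (p : S → ℝ) (hp0 : ∀ s, 0 ≤ p s)
    (hp1 : ∑ s, p s = 1)
    (x : S → Fin N → ℝ) (m : Fin N → ℝ) (c : Fin N → Fin N → ℝ)
    (hm : ∀ i, m i = ∑ s, x s i * p s)
    (hc : ∀ i j, c i j = (∑ s, x s i * x s j * p s) - m i * m j) (u : Fin N → ℝ) :
    0 ≤ ∑ i, u i * ∑ j, c i j * u j := by
  have hc' : ∀ i j, c i j = ∑ s, (x s i - m i) * (x s j - m j) * p s := by
    intro i j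
    have : (∑ s, (x s i - m i) * (x s j - m j) * p s) = (∑ s, x s i * x s j * p s)
        - m j * (∑ s, x s i * p s) - m i * (∑ s, x s j * p s) + m i * m j * ∑ s, p s := by
      simp only [Finset.mul_sum, ← Finset.sum_add_distrib, ← Finset.sum_sub_distrib]
      exact Finset.sum_congr rfl fun s _ => by ring
    rw [this, hc, ← hm, ← hm, hp1]
    ring
  have : (∑ i, u i * ∑ j, c i j * u j) = ∑ s, (∑ i, u i * (x s i - m i)) ^ 2 * p s := by
    simp only [hc', sq, Finset.sum_mul_sum, Finset.sum_mul, Finset.mul_sum]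
    rw [Finset.sum_comm (s := (Finset.univ : Finset S))]
    refine Finset.sum_congr rfl fun i _ => ?_
    rw [Finset.sum_comm (s := (Finset.univ : Finset S))]
    refine Finset.sum_congr rfl fun j _ => Finset.sum_congr rfl fun s _ => ?_
    ring
  rw [this]
  exact Finset.sum_nonneg fun s _ => mul_nonneg (sq_nonneg _) (hp0 s)

/-- Gibbs weight. -/
def gw (N : ℕ) (β : ℝ) (g : Fin N → Fin N → ℝ) (hv : Fin N → ℝ) (s : Fin N → Bool) : ℝ :=
  Real.exp (hamiltonian N β g hv (fun i => spin (s i))) / partitionZ N β g hv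

theorem partitionZ_pos (N : ℕ) (β : ℝ) (g : Fin N → Fin N → ℝ) (hv : Fin N → ℝ) :
    0 < partitionZ N β g hv :=
  Finset.sum_pos (fun _ _ => Real.exp_pos _) Finset.univ_nonempty

theorem gw_nonneg (N : ℕ) (β : ℝ) (g : Fin N → Fin N → ℝ) (hv : Fin N → ℝ) (s) :
    0 ≤ gw N β g hv s := div_nonneg (Real.exp_pos _).le (partitionZ_pos N β g hv).le

theorem gw_sum (N : ℕ) (β : ℝ) (g : Fin N → Fin N → ℝ) (hv : Fin N → ℝ) :
    ∑ s, gw N β g hv s = 1 := by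
  unfold gw
  rw [← Finset.sum_div]
  exact div_self (partitionZ_pos N β g hv).ne'

theorem gibbs_eq (N : ℕ) (β : ℝ) (g : Fin N → Fin N → ℝ) (hv : Fin N → ℝ) (f) :
    gibbs N β g hv f = ∑ s : Fin N → Bool, f (fun i => spin (s i)) * gw N β g hv s := by
  unfold gibbs gw
  rw [Finset.sum_div]
  exact Finset.sum_congr rfl fun s _ => by ring

theorem gibbs2_eq (N : ℕ) (β : ℝ) (g : Fin N → Fin N → ℝ) (hv : Fin N → ℝ) (f) :
    gibbs2 N β g hv f = ∑ s : Fin N → Bool, ∑ t : Fin N → Bool,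
      f (fun i => spin (s i)) (fun i => spin (t i)) * (gw N β g hv s * gw N β g hv t) := by
  unfold gibbs2 gw
  simp only [Finset.sum_div, Real.exp_add]
  exact Finset.sum_congr rfl fun s _ => Finset.sum_congr rfl fun t _ => by ring

theorem mag_sq_le (N : ℕ) (β : ℝ) (g : Fin N → Fin N → ℝ) (hv : Fin N → ℝ) (i) :
    mag N β g hv i ^ 2 ≤ 1 := by
  rw [sq_le_one_iff_abs_le_one, mag, gibbs_eq, ← gw_sum N β g hv]
  refine (Finset.abs_sum_le_sum_abs _ _).trans (Finset.sum_le_sum fun s _ => ?_)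
  rw [abs_mul, abs_of_nonneg (gw_nonneg N β g hv s)]
  have : |spin (s i)| = 1 := by unfold spin; split <;> simp
  rw [this, one_mul]

/-- For every `N ≥ 1`, every `β > 0`, `h > 0` and every symmetric
zero-diagonal coupling matrix `g`, one has
`⟨(R - ⟨R⟩)²⟩ = N⁻² tr(MᵀM) + 2 N⁻² (m, M m)`, and consequently
`N⁻² ‖M‖_op² ≤ ⟨(R - ⟨R⟩)²⟩ ≤ N⁻¹ (‖M‖_op² + 2 ‖M‖_op)`. -/
theorem overlap_fluctuations_vs_correlation_matrix
    (N : ℕ) (hN : 0 < N) (β h : ℝ) (hβ : 0 < β) (hh : 0 < h)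
    (g : Fin N → Fin N → ℝ) (hsym : ∀ i j, g i j = g j i) (hdiag : ∀ i, g i i = 0) :
    (gibbs2 N β g (fun _ => h) (fun σ τ =>
        (overlap N σ τ - gibbs2 N β g (fun _ => h) (overlap N)) ^ 2)
      = ((N : ℝ) ^ 2)⁻¹ *
          (∑ i, ∑ j, (corr N β g (fun _ => h) i j) ^ 2)
        + 2 * ((N : ℝ) ^ 2)⁻¹ *
          (∑ i, mag N β g (fun _ => h) i *
            ∑ j, corr N β g (fun _ => h) i j * mag N β g (fun _ => h) j)) ∧
    ((N : ℝ) ^ 2)⁻¹ * opNorm N (fun i j => corr N β g (fun _ => h) i j) ^ 2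
      ≤ gibbs2 N β g (fun _ => h) (fun σ τ =>
          (overlap N σ τ - gibbs2 N β g (fun _ => h) (overlap N)) ^ 2) ∧
    gibbs2 N β g (fun _ => h) (fun σ τ =>
        (overlap N σ τ - gibbs2 N β g (fun _ => h) (overlap N)) ^ 2)
      ≤ (N : ℝ)⁻¹ * (opNorm N (fun i j => corr N β g (fun _ => h) i j) ^ 2
          + 2 * opNorm N (fun i j => corr N β g (fun _ => h) i j)) := by
  have hm : ∀ i, mag N β g (fun _ => h) i
      = ∑ s : Fin N → Bool, spin (s i) * gw N β g (fun _ => h) s := fun i => gibbs_eq _ _ _ _ _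
  have hc : ∀ i j, corr N β g (fun _ => h) i j
      = (∑ s : Fin N → Bool, spin (s i) * spin (s j) * gw N β g (fun _ => h) s)
        - mag N β g (fun _ => h) i * mag N β g (fun _ => h) j := fun i j => by
    rw [corr, gibbs_eq]
  have hp1 := gw_sum N β g (fun _ => h)
  have key : gibbs2 N β g (fun _ => h) (fun σ τ =>
        (overlap N σ τ - gibbs2 N β g (fun _ => h) (overlap N)) ^ 2)
      = ((N : ℝ) ^ 2)⁻¹ *
          (∑ i, ∑ j, (corr N β g (fun _ => h) i j) ^ 2)
        + 2 * ((N : ℝ) ^ 2)⁻¹ *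
          (∑ i, mag N β g (fun _ => h) i *
            ∑ j, corr N β g (fun _ => h) i j * mag N β g (fun _ => h) j) := by
    rw [gibbs2_eq, gibbs2_eq]
    exact abstract_identity N _ hp1 (fun (s : Fin N → Bool) i => spin (s i)) _ _ hm hc
  have psd := abstract_psd N _ (gw_nonneg N β g (fun _ => h)) hp1
    (fun (s : Fin N → Bool) i => spin (s i)) _ _ hm hc (mag N β g (fun _ => h))
  have hmb := mag_sq_le N β g (fun _ => h)
  have hNr : (0 : ℝ) < N := by exact_mod_cast hN
  rw [key]
  clear key hm hc hp1
  refine ⟨rfl, ?_, ?_⟩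
  · have h1 := opNorm_sq_le N (fun i j => corr N β g (fun _ => h) i j)
    have h2 := mul_le_mul_of_nonneg_left h1 (show 0 ≤ ((N : ℝ) ^ 2)⁻¹ by positivity)
    have h3 := mul_nonneg (show 0 ≤ 2 * ((N : ℝ) ^ 2)⁻¹ by positivity) psd
    linarith
  · clear psd
    generalize corr N β g (fun _ => h) = A at *
    generalize mag N β g (fun _ => h) = m at *
    have hK0 := opNorm_nonneg N A
    have hK := le_opNorm N A
    change _ ≤ (N : ℝ)⁻¹ * (opNorm N A ^ 2 + 2 * opNorm N A)
    generalize opNorm N A = K at *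
    have hF : ∑ i, ∑ j, A i j ^ 2 ≤ N * K ^ 2 := by
      rw [Finset.sum_comm]
      calc _ ≤ ∑ j : Fin N, K ^ 2 := Finset.sum_le_sum fun j _ => by
            simpa [Pi.single_apply] using hK (Pi.single j 1)
        _ = _ := by simp
    have hM : ∑ i, m i ^ 2 ≤ N := by
      calc _ ≤ ∑ i : Fin N, (1 : ℝ) := Finset.sum_le_sum fun i _ => hmb i
        _ = _ := by simp
    have hM0 : 0 ≤ ∑ i, m i ^ 2 := Finset.sum_nonneg fun i _ => sq_nonneg _
    have hQ : (∑ i, m i * ∑ j, A i j * m j) ≤ N * K := by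
      refine (abs_le_of_sq_le_sq' ?_ (by positivity)).2
      calc _ ≤ (∑ i, m i ^ 2) * ∑ i, (∑ j, A i j * m j) ^ 2 :=
            Finset.sum_mul_sq_le_sq_mul_sq _ _ _
        _ ≤ (∑ i, m i ^ 2) * (K ^ 2 * ∑ i, m i ^ 2) := mul_le_mul_of_nonneg_left (hK m) hM0
        _ = K ^ 2 * (∑ i, m i ^ 2) ^ 2 := by ring
        _ ≤ K ^ 2 * (N : ℝ) ^ 2 := by gcongr
        _ = _ := by ring
    calc _ ≤ ((N : ℝ) ^ 2)⁻¹ * (N * K ^ 2) + 2 * ((N : ℝ) ^ 2)⁻¹ * (N * K) := by gcongr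
      _ = _ := by field_simp

end SK
end
end

section
/- For every 0 < β < 1 and every h > 0, with q the unique solution of q = E tanh²(h + β√q Z), it holds that (∂_m Φ)(m,q')|_{m=1} < 0 for all q < q' ≤ 1. In particular, the AT condition and condition (AT+) are satisfied for all (β,h) ∈ (0,1) × (0,∞). -/
open MeasureTheory ProbabilityTheory Real Filter

noncomputable section

namespace SK

/-- The standard Gaussian. -/
abbrev γ : Measure ℝ := gaussianReal 0 1

lemma integrable_exp_abs (c : ℝ) : Integrable (fun x => exp (c * |x|)) γ := by
  have h1 : Integrable (fun x => exp (c * x) + exp (-c * x)) γ :=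
    (integrable_exp_mul_gaussianReal c).add (integrable_exp_mul_gaussianReal (-c))
  refine h1.mono' (by fun_prop) (ae_of_all _ fun x => ?_)
  rw [Real.norm_eq_abs, abs_of_pos (exp_pos _)]
  rcases abs_cases x with ⟨h, _⟩ | ⟨h, _⟩ <;> rw [h]
  · linarith [exp_pos (-c * x)]
  · have : c * -x = -c * x := by ring
    rw [this]; linarith [exp_pos (c * x)]

lemma integrable_of_bound {f : ℝ → ℝ} (hf : AEStronglyMeasurable f γ) (K c : ℝ)
    (h : ∀ x, |f x| ≤ K * exp (c * |x|)) : Integrable f γ :=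
  ((integrable_exp_abs c).const_mul K).mono' hf (ae_of_all _ h)

lemma cosh_le_exp_abs (x : ℝ) : cosh x ≤ exp |x| := by
  rw [← cosh_abs, cosh_eq]
  have : exp (-|x|) ≤ exp |x| := exp_le_exp.2 (by linarith [abs_nonneg x])
  linarith

lemma abs_sinh_le_cosh (x : ℝ) : |sinh x| ≤ cosh x := by
  apply abs_le_of_sq_le_sq _ (cosh_pos x).le
  rw [cosh_sq]; linarith

lemma log_cosh_nonneg (x : ℝ) : 0 ≤ log (cosh x) := log_nonneg (one_le_cosh x)

lemma log_cosh_le (x : ℝ) : log (cosh x) ≤ cosh x :=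
  (log_le_sub_one_of_pos (cosh_pos x)).trans (by linarith)

lemma log_cosh_le_abs (x : ℝ) : log (cosh x) ≤ |x| :=
  (log_le_log (cosh_pos x) (cosh_le_exp_abs x)).trans (by rw [log_exp])

lemma exp_abs_affine (c y r : ℝ) (hc : 0 ≤ c) (z : ℝ) :
    exp (c * |y + r * z|) ≤ exp (c * |y|) * exp (c * |r| * |z|) := by
  rw [← exp_add]
  apply exp_le_exp.2
  have := abs_add_le y (r * z)
  rw [abs_mul] at this
  nlinarith

lemma integrable_affine {f : ℝ → ℝ} (hf : Measurable f) (K c : ℝ) (hK : 0 ≤ K) (hc : 0 ≤ c)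
    (h : ∀ x, |f x| ≤ K * exp (c * |x|)) (y r : ℝ) : Integrable (fun z => f (y + r * z)) γ := by
  refine integrable_of_bound ?_ (K * exp (c * |y|)) (c * |r|) fun z => ?_
  · exact (hf.comp (by fun_prop)).aestronglyMeasurable
  · calc _ ≤ K * exp (c * |y + r * z|) := h _
      _ ≤ K * (exp (c * |y|) * exp (c * |r| * |z|)) := by
        gcongr; exact exp_abs_affine c y r hc z
      _ = _ := by ring

lemma measurable_log_cosh : Measurable (fun x => log (cosh x)) :=
  measurable_log.comp measurable_cosh

lemma integrable_cosh (y r : ℝ) : Integrable (fun z => cosh (y + r * z)) γ :=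
  integrable_affine measurable_cosh 1 1 (by norm_num) (by norm_num) (fun x => by
    rw [abs_of_pos (cosh_pos x)]; simpa using cosh_le_exp_abs x) y r

lemma integral_cosh (y r : ℝ) : ∫ z, cosh (y + r * z) ∂γ = exp (r ^ 2 / 2) * cosh y := by
  have key : ∀ t : ℝ, ∫ z, exp (t * z) ∂γ = exp (t ^ 2 / 2) := fun t => by
    have := congrFun (mgf_id_gaussianReal (μ := 0) (v := 1)) t
    simpa [mgf] using this
  have e : ∀ z, cosh (y + r * z) = exp y / 2 * exp (r * z) + exp (-y) / 2 * exp (-r * z) := by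
    intro z
    rw [cosh_eq, exp_add, neg_add, exp_add, neg_mul]; ring
  simp_rw [e]
  rw [integral_add ((integrable_exp_mul_gaussianReal r).const_mul _)
    ((integrable_exp_mul_gaussianReal (-r)).const_mul _), integral_const_mul, integral_const_mul,
    key, key, cosh_eq]
  simp only [neg_sq]; ring

lemma integrable_sech (y r : ℝ) : Integrable (fun z => (cosh (y + r * z))⁻¹) γ :=
  integrable_affine (f := fun x => (cosh x)⁻¹) measurable_cosh.inv 1 1 (by norm_num) (by norm_num) (fun x => by
    rw [abs_of_pos (inv_pos.2 (cosh_pos x))]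
    have : (cosh x)⁻¹ ≤ 1 := inv_le_one_of_one_le₀ (one_le_cosh x)
    have : 1 ≤ exp (1 * |x|) := one_le_exp (by simp)
    linarith) y r

lemma integral_sech_ge (y r : ℝ) :
    exp (-(r ^ 2 / 2)) * (cosh y)⁻¹ ≤ ∫ z, (cosh (y + r * z))⁻¹ ∂γ := by
  set c := exp (r ^ 2 / 2) * cosh y with hc
  have cpos : 0 < c := mul_pos (exp_pos _) (cosh_pos _)
  have h : ∫ z, (2 * c⁻¹ - (c⁻¹) ^ 2 * cosh (y + r * z)) ∂γ ≤ ∫ z, (cosh (y + r * z))⁻¹ ∂γ := by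
    apply integral_mono ((integrable_const _).sub ((integrable_cosh y r).const_mul _))
      (integrable_sech y r)
    intro z
    have hx := cosh_pos (y + r * z)
    have : 0 ≤ (cosh (y + r * z))⁻¹ * (1 - c⁻¹ * cosh (y + r * z)) ^ 2 := by positivity
    have e : (cosh (y + r * z))⁻¹ * (1 - c⁻¹ * cosh (y + r * z)) ^ 2 =
      (cosh (y + r * z))⁻¹ - (2 * c⁻¹ - (c⁻¹) ^ 2 * cosh (y + r * z)) := by
      field_simp; ring
    change 2 * c⁻¹ - (c⁻¹) ^ 2 * cosh (y + r * z) ≤ (cosh (y + r * z))⁻¹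
    linarith
  rw [integral_sub (integrable_const _) ((integrable_cosh y r).const_mul _),
    integral_const_mul (c⁻¹ ^ 2), integral_cosh, ← hc] at h
  have e2 : exp (-(r ^ 2 / 2)) * (cosh y)⁻¹ = c⁻¹ := by rw [hc, mul_inv, exp_neg]
  rw [e2]
  have : (c⁻¹) ^ 2 * c = c⁻¹ := by field_simp
  simp at h
  simp at this
  linarith

lemma F1_bound (y r : ℝ) :
    exp (-(r ^ 2 / 2)) * ∫ z, (cosh (y + r * z) - (cosh (y + r * z))⁻¹) ∂γ
      ≤ cosh y - (cosh y)⁻¹ + r ^ 2 * cosh y := by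
  rw [integral_sub (integrable_cosh y r) (integrable_sech y r), integral_cosh]
  have h := integral_sech_ge y r
  have h2 := mul_le_mul_of_nonneg_left h (exp_pos (-(r ^ 2 / 2))).le
  have e1 : exp (-(r ^ 2 / 2)) * exp (r ^ 2 / 2) = 1 := by rw [← exp_add]; simp
  have e2 : exp (-(r ^ 2 / 2)) * exp (-(r ^ 2 / 2)) = exp (-r ^ 2) := by
    rw [← exp_add]; congr 1; ring
  have e3 : 1 - r ^ 2 ≤ exp (-r ^ 2) := by linarith [add_one_le_exp (-r ^ 2)]
  have hi : 0 < (cosh y)⁻¹ := inv_pos.2 (cosh_pos y)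
  have hi1 : (cosh y)⁻¹ ≤ 1 := inv_le_one_of_one_le₀ (one_le_cosh y)
  have hc := one_le_cosh y
  rw [← mul_assoc, e2] at h2
  rw [mul_sub, ← mul_assoc, e1]
  have h3 := mul_le_mul_of_nonneg_right e3 hi.le
  nlinarith [sq_nonneg r]

lemma integral_gamma (f : ℝ → ℝ) :
    ∫ z, f z ∂γ = ∫ z, gaussianPDFReal 0 1 z * f z := by
  rw [integral_gaussianReal_eq_integral_smul (by norm_num)]; rfl

lemma integrable_gamma {f : ℝ → ℝ} (hf : Integrable f γ) :
    Integrable (fun z => gaussianPDFReal 0 1 z * f z) := by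
  rw [γ, gaussianReal_of_var_ne_zero 0 (by norm_num),
    integrable_withDensity_iff_integrable_smul' (measurable_gaussianPDF 0 1)
      (ae_of_all _ fun x => gaussianPDF_lt_top)] at hf
  simpa [toReal_gaussianPDF] using hf

lemma hasDerivAt_pdf (z : ℝ) :
    HasDerivAt (gaussianPDFReal 0 1) (-z * gaussianPDFReal 0 1 z) z := by
  have : gaussianPDFReal 0 1 = fun x => (√(2 * π))⁻¹ * exp (-x ^ 2 / 2) := by
    ext x; simp [gaussianPDFReal]
  rw [this]
  have h := (((hasDerivAt_id z).pow 2).neg.div_const 2).exp.const_mul ((√(2 * π))⁻¹)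
  refine h.congr_deriv ?_
  simp
  ring

lemma stein {u u' : ℝ → ℝ} (hu : ∀ x, HasDerivAt u (u' x) x) (i0 : Integrable u γ)
    (i1 : Integrable u' γ) (i2 : Integrable (fun z => u z * z) γ) :
    ∫ z, u z * z ∂γ = ∫ z, u' z ∂γ := by
  have h := integral_mul_deriv_eq_deriv_mul_of_integrable (u := u) (u' := u')
    (v := gaussianPDFReal 0 1) (v' := fun z => -z * gaussianPDFReal 0 1 z)
    (fun x _ => hu x) (fun x _ => hasDerivAt_pdf x)
    (by
      refine (integrable_gamma i2).neg.congr (ae_of_all _ fun z => ?_)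
      simp; ring)
    (by
      refine (integrable_gamma i1).congr (ae_of_all _ fun z => ?_)
      simp; ring)
    (by
      refine (integrable_gamma i0).congr (ae_of_all _ fun z => ?_)
      simp; ring)
  rw [integral_gamma, integral_gamma]
  have e1 : ∫ z, u z * (-z * gaussianPDFReal 0 1 z) = - ∫ z, gaussianPDFReal 0 1 z * (u z * z) := by
    rw [← integral_neg]; congr 1; ext z; ring
  have e2 : ∫ z, u' z * gaussianPDFReal 0 1 z = ∫ z, gaussianPDFReal 0 1 z * u' z := by
    congr 1; ext z; ring
  rw [e1, e2] at h
  linarith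

/-- `cosh · log cosh`. -/
def F0 (x : ℝ) : ℝ := cosh x * log (cosh x)
/-- The derivative of `F0`. -/
def F0d (x : ℝ) : ℝ := sinh x * log (cosh x) + sinh x
/-- The second derivative of `F0`. -/
def F0dd (x : ℝ) : ℝ := cosh x * log (cosh x) + (cosh x - (cosh x)⁻¹) + cosh x

lemma hasDerivAt_F0 (x : ℝ) : HasDerivAt F0 (F0d x) x := by
  have h1 := hasDerivAt_cosh x
  have h := h1.mul (h1.log (cosh_pos x).ne')
  refine h.congr_deriv ?_
  have := (cosh_pos x).ne'
  simp only [F0d]; field_simp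

lemma hasDerivAt_F0d (x : ℝ) : HasDerivAt F0d (F0dd x) x := by
  have h1 := hasDerivAt_cosh x
  have h2 := hasDerivAt_sinh x
  have h := (h2.mul (h1.log (cosh_pos x).ne')).add h2
  refine h.congr_deriv ?_
  have := (cosh_pos x).ne'
  have e : sinh x * (sinh x / cosh x) = cosh x - (cosh x)⁻¹ := by
    field_simp; rw [cosh_sq]; ring
  simp only [F0dd]; rw [e]

lemma measurable_F0 : Measurable F0 := measurable_cosh.mul measurable_log_cosh
lemma measurable_F0d : Measurable F0d :=
  (measurable_sinh.mul measurable_log_cosh).add measurable_sinh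
lemma measurable_F0dd : Measurable F0dd :=
  (measurable_F0.add (measurable_cosh.sub measurable_cosh.inv)).add measurable_cosh

lemma exp_two_abs (x : ℝ) : cosh x * cosh x ≤ exp (2 * |x|) := by
  have : exp (2 * |x|) = exp |x| * exp |x| := by rw [← exp_add]; congr 1; ring
  rw [this]
  have := cosh_le_exp_abs x
  have := cosh_pos x
  gcongr

lemma F0_bound (x : ℝ) : |F0 x| ≤ 1 * exp (2 * |x|) := by
  have h0 := log_cosh_nonneg x
  have hc := cosh_pos x
  rw [F0, abs_of_nonneg (by positivity), one_mul]
  exact (mul_le_mul_of_nonneg_left (log_cosh_le x) hc.le).trans (exp_two_abs x)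

lemma F0d_bound (x : ℝ) : |F0d x| ≤ 2 * exp (2 * |x|) := by
  have h0 := log_cosh_nonneg x
  have hl := log_cosh_le x
  have hc := one_le_cosh x
  have hs := abs_sinh_le_cosh x
  have h2 := exp_two_abs x
  have : |F0d x| = |sinh x| * (log (cosh x) + 1) := by
    rw [F0d, ← mul_add_one, abs_mul, abs_of_nonneg (by linarith : 0 ≤ log (cosh x) + 1)]
  rw [this]
  have := abs_nonneg (sinh x)
  nlinarith

lemma F0dd_bound (x : ℝ) : |F0dd x| ≤ 3 * exp (2 * |x|) := by
  have h0 := log_cosh_nonneg x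
  have hl := log_cosh_le x
  have hc := one_le_cosh x
  have h2 := exp_two_abs x
  have hi : 0 < (cosh x)⁻¹ := inv_pos.2 (cosh_pos x)
  have hi1 : (cosh x)⁻¹ ≤ 1 := inv_le_one_of_one_le₀ hc
  have hp : 0 ≤ cosh x * log (cosh x) := by positivity
  rw [F0dd, abs_of_nonneg (by linarith)]
  nlinarith

lemma integrable_F0 (y r : ℝ) : Integrable (fun z => F0 (y + r * z)) γ :=
  integrable_affine measurable_F0 1 2 (by norm_num) (by norm_num) F0_bound y r

lemma F0d_mul_bound (y r R z : ℝ) (hr : |r| ≤ R) :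
    |F0d (y + r * z) * z| ≤ 2 * exp (2 * |y|) * exp ((2 * R + 1) * |z|) := by
  rw [abs_mul]
  have h1 := F0d_bound (y + r * z)
  have h2 := exp_abs_affine 2 y r (by norm_num) z
  have h3 : exp (2 * |r| * |z|) ≤ exp (2 * R * |z|) := by
    apply exp_le_exp.2; gcongr
  have h4 : |z| ≤ exp |z| := by linarith [add_one_le_exp |z|]
  calc _ ≤ (2 * (exp (2 * |y|) * exp (2 * R * |z|))) * exp |z| := by
        gcongr
        refine h1.trans ?_
        gcongr
        refine h2.trans ?_
        gcongr
    _ = _ := by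
      have : (2 * R + 1) * |z| = 2 * R * |z| + |z| := by ring
      rw [this, exp_add]; ring

lemma integrable_F0d_mul (y r : ℝ) : Integrable (fun z => F0d (y + r * z) * z) γ :=
  integrable_of_bound
    ((measurable_F0d.comp (by fun_prop)).mul measurable_id).aestronglyMeasurable _ _
    (fun z => F0d_mul_bound y r |r| z le_rfl)

lemma stein_F0 (y r : ℝ) :
    ∫ z, F0d (y + r * z) * z ∂γ = r * ∫ z, F0dd (y + r * z) ∂γ := by
  rw [← integral_const_mul]
  refine stein (u := fun z => F0d (y + r * z)) (u' := fun z => r * F0dd (y + r * z)) ?_ ?_ ?_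
    (integrable_F0d_mul y r)
  · intro x
    have h := (hasDerivAt_F0d (y + r * x)).comp x (((hasDerivAt_id x).const_mul r).const_add y)
    refine h.congr_deriv ?_
    simp; ring
  · exact integrable_affine measurable_F0d 2 2 (by norm_num) (by norm_num) F0d_bound y r
  · exact (integrable_affine measurable_F0dd 3 2 (by norm_num) (by norm_num) F0dd_bound y r).const_mul r

lemma hasDerivAt_A (y r : ℝ) :
    HasDerivAt (fun r => ∫ z, F0 (y + r * z) ∂γ)
      (r * (∫ z, F0 (y + r * z) ∂γ + ∫ z, (cosh (y + r * z) - (cosh (y + r * z))⁻¹) ∂γ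
        + exp (r ^ 2 / 2) * cosh y)) r := by
  have h := (hasDerivAt_integral_of_dominated_loc_of_deriv_le (μ := γ) (x₀ := r)
    (s := Metric.ball r 1) (F := fun r z => F0 (y + r * z))
    (F' := fun r z => F0d (y + r * z) * z)
    (bound := fun z => 2 * exp (2 * |y|) * exp ((2 * (|r| + 1) + 1) * |z|))
    (Metric.ball_mem_nhds r one_pos)
    (Eventually.of_forall fun r => (integrable_F0 y r).aestronglyMeasurable)
    (integrable_F0 y r) (integrable_F0d_mul y r).aestronglyMeasurable
    (ae_of_all _ fun z x hx => F0d_mul_bound y x (|r| + 1) z (by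
      rw [Metric.mem_ball, Real.dist_eq] at hx
      have := abs_add_le (x - r) r
      rw [sub_add_cancel] at this
      linarith))
    ((integrable_exp_abs _).const_mul _)
    (ae_of_all _ fun z x _ => by
      have h := (hasDerivAt_F0 (y + x * z)).comp x (((hasDerivAt_id x).mul_const z).const_add y)
      refine h.congr_deriv ?_
      simp)).2
  refine h.congr_deriv ?_
  have i0 := integrable_F0 y r
  have i1 : Integrable (fun z => cosh (y + r * z) - (cosh (y + r * z))⁻¹) γ :=
    (integrable_cosh y r).sub (integrable_sech y r)
  have i01 : Integrable (fun z => F0 (y + r * z) + (cosh (y + r * z) - (cosh (y + r * z))⁻¹)) γ :=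
    i0.add i1
  rw [stein_F0, ← integral_cosh, ← integral_add i0 i1, ← integral_add i01 (integrable_cosh y r)]
  rfl

lemma A_bound (y r : ℝ) (hr : 0 ≤ r) :
    exp (-(r ^ 2 / 2)) * ∫ z, F0 (y + r * z) ∂γ
      ≤ F0 y + r ^ 2 / 2 * (cosh y + (cosh y - (cosh y)⁻¹)) + r ^ 4 / 4 * cosh y := by
  set D : ℝ → ℝ := fun r =>
    F0 y + r ^ 2 / 2 * (cosh y + (cosh y - (cosh y)⁻¹)) + r ^ 4 / 4 * cosh y
      - exp (-(r ^ 2 / 2)) * ∫ z, F0 (y + r * z) ∂γ with hD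
  set B : ℝ → ℝ := fun r => ∫ z, (cosh (y + r * z) - (cosh (y + r * z))⁻¹) ∂γ with hB
  have hd : ∀ x, HasDerivAt D (x * (cosh y - (cosh y)⁻¹ + x ^ 2 * cosh y
      - exp (-(x ^ 2 / 2)) * B x)) x := by
    intro x
    have h2 := ((hasDerivAt_pow 2 x).div_const 2)
    have h4 := ((hasDerivAt_pow 4 x).div_const 4)
    have h := (((h2.mul_const (cosh y + (cosh y - (cosh y)⁻¹))).const_add (F0 y)).add
      (h4.mul_const (cosh y))).sub (h2.neg.exp.mul (hasDerivAt_A y x))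
    refine h.congr_deriv ?_
    have e1 : exp (-(x ^ 2 / 2)) * exp (x ^ 2 / 2) = 1 := by rw [← exp_add]; simp
    simp only [hB, Pi.neg_apply]
    push_cast
    linear_combination (-x * cosh y) * e1
  have mono : MonotoneOn D (Set.Ici 0) := by
    apply monotoneOn_of_deriv_nonneg (convex_Ici 0)
    · exact fun x _ => (hd x).continuousAt.continuousWithinAt
    · exact fun x _ => (hd x).differentiableAt.differentiableWithinAt
    · intro x hx
      rw [interior_Ici, Set.mem_Ioi] at hx
      rw [(hd x).deriv]
      have := F1_bound y x
      exact mul_nonneg hx.le (by linarith)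
  have h0 : D 0 = 0 := by simp [hD]
  have := mono (Set.mem_Ici.2 le_rfl) (Set.mem_Ici.2 hr) hr
  rw [h0] at this
  simp only [hD] at this
  linarith

/-- The pointwise bound on the tilted expectation of `log cosh`. -/
lemma tilted_bound (y r : ℝ) (hr : 0 ≤ r) :
    (∫ z, cosh (y + r * z) * log (cosh (y + r * z)) ∂γ) / (exp (r ^ 2 / 2) * cosh y)
      ≤ log (cosh y) + r ^ 2 / 2 * (1 + tanh y ^ 2) + r ^ 4 / 4 := by
  have h := A_bound y r hr
  have hc := cosh_pos y
  have he : exp (r ^ 2 / 2) * exp (-(r ^ 2 / 2)) = 1 := by rw [← exp_add]; simp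
  have h2 := mul_le_mul_of_nonneg_left h (exp_pos (r ^ 2 / 2)).le
  rw [← mul_assoc, he, one_mul] at h2
  rw [div_le_iff₀ (by positivity)]
  refine h2.trans (le_of_eq ?_)
  have e : tanh y ^ 2 * cosh y = cosh y - (cosh y)⁻¹ := by
    rw [tanh_eq_sinh_div_cosh]; field_simp; rw [cosh_sq]; ring
  rw [F0, ← e]; ring

lemma cosh_rpow_le (x m : ℝ) (hm : m ≤ 2) : cosh x ^ m ≤ exp (2 * |x|) := by
  refine le_trans ?_ (exp_two_abs x)
  calc cosh x ^ m ≤ cosh x ^ (2 : ℝ) := rpow_le_rpow_of_exponent_le (one_le_cosh x) hm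
    _ = _ := by rw [rpow_two, sq]

lemma one_le_cosh_rpow (x m : ℝ) (hm : 0 ≤ m) : 1 ≤ cosh x ^ m :=
  one_le_rpow (one_le_cosh x) hm

lemma cosh_rpow_mul_log_nonneg (x m : ℝ) : 0 ≤ cosh x ^ m * log (cosh x) :=
  mul_nonneg (rpow_nonneg (cosh_pos x).le m) (log_cosh_nonneg x)

lemma cosh_rpow_mul_log_le (x m : ℝ) (hm : m ≤ 2) :
    |cosh x ^ m * log (cosh x)| ≤ 1 * exp (3 * |x|) := by
  rw [abs_of_nonneg (cosh_rpow_mul_log_nonneg x m)]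
  have h1 := cosh_rpow_le x m hm
  have h2 := (log_cosh_le x).trans (cosh_le_exp_abs x)
  have e : exp (3 * |x|) = exp (2 * |x|) * exp |x| := by rw [← exp_add]; congr 1; ring
  rw [e, one_mul]
  exact mul_le_mul h1 h2 (log_cosh_nonneg x) (exp_pos _).le

lemma mem_ball_one {m : ℝ} (hm : m ∈ Metric.ball (1 : ℝ) 1) : 0 < m ∧ m < 2 := by
  rw [Metric.mem_ball, Real.dist_eq, abs_lt] at hm
  constructor <;> linarith

lemma measurable_cosh_rpow (m : ℝ) : Measurable (fun x => cosh x ^ m) :=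
  measurable_cosh.pow_const m

lemma integrable_cosh_rpow (y r m : ℝ) (hm : m ∈ Metric.ball (1 : ℝ) 1) :
    Integrable (fun z => cosh (y + r * z) ^ m) γ :=
  integrable_affine (measurable_cosh_rpow m) 1 2 (by norm_num) (by norm_num) (fun x => by
    rw [abs_of_nonneg (rpow_nonneg (cosh_pos x).le m), one_mul]
    exact cosh_rpow_le x m (mem_ball_one hm).2.le) y r

lemma integrable_cosh_rpow_log (y r m : ℝ) (hm : m ∈ Metric.ball (1 : ℝ) 1) :
    Integrable (fun z => cosh (y + r * z) ^ m * log (cosh (y + r * z))) γ :=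
  integrable_affine (f := fun x => cosh x ^ m * log (cosh x))
    ((measurable_cosh_rpow m).mul measurable_log_cosh) 1 3 (by norm_num) (by norm_num)
    (fun x => cosh_rpow_mul_log_le x m (mem_ball_one hm).2.le) y r

lemma integral_cosh_rpow_ge (y r m : ℝ) (hm : m ∈ Metric.ball (1 : ℝ) 1) :
    1 ≤ ∫ z, cosh (y + r * z) ^ m ∂γ := by
  have := integral_mono (integrable_const (1 : ℝ)) (integrable_cosh_rpow y r m hm)
    (fun z => one_le_cosh_rpow (y + r * z) m (mem_ball_one hm).1.le)
  simpa using this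

lemma hasDerivAt_inner (y r m : ℝ) (hm : m ∈ Metric.ball (1 : ℝ) 1) :
    HasDerivAt (fun m => ∫ z, cosh (y + r * z) ^ m ∂γ)
      (∫ z, cosh (y + r * z) ^ m * log (cosh (y + r * z)) ∂γ) m :=
  (hasDerivAt_integral_of_dominated_loc_of_deriv_le (μ := γ) (x₀ := m)
    (s := Metric.ball (1 : ℝ) 1) (F := fun m z => cosh (y + r * z) ^ m)
    (F' := fun m z => cosh (y + r * z) ^ m * log (cosh (y + r * z)))
    (bound := fun z => exp (3 * |y|) * exp (3 * |r| * |z|))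
    (Metric.isOpen_ball.mem_nhds hm)
    (Eventually.of_forall fun m =>
      ((measurable_cosh_rpow m).comp (by fun_prop)).aestronglyMeasurable)
    (integrable_cosh_rpow y r m hm) (integrable_cosh_rpow_log y r m hm).aestronglyMeasurable
    (ae_of_all _ fun z x hx => by
      refine (cosh_rpow_mul_log_le (y + r * z) x (mem_ball_one hx).2.le).trans ?_
      rw [one_mul]
      exact exp_abs_affine 3 y r (by norm_num) z)
    ((integrable_exp_abs _).const_mul _)
    (ae_of_all _ fun z x _ => by
      have h := (hasDerivAt_id x).const_rpow (cosh_pos (y + r * z))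
      refine h.congr_deriv ?_
      simp; ring)).2

lemma inner_deriv_bound (y r m : ℝ) (hm : m ∈ Metric.ball (1 : ℝ) 1) :
    |(∫ z, cosh (y + r * z) ^ m * log (cosh (y + r * z)) ∂γ) / ∫ z, cosh (y + r * z) ^ m ∂γ|
      ≤ (∫ z, exp (3 * |r| * |z|) ∂γ) * exp (3 * |y|) := by
  have h1 := integral_cosh_rpow_ge y r m hm
  have h0 : 0 ≤ ∫ z, cosh (y + r * z) ^ m * log (cosh (y + r * z)) ∂γ :=
    integral_nonneg fun z => cosh_rpow_mul_log_nonneg _ _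
  rw [abs_of_nonneg (by positivity)]
  refine (div_le_self h0 h1).trans ?_
  rw [mul_comm, ← integral_const_mul]
  refine integral_mono (integrable_cosh_rpow_log y r m hm) ((integrable_exp_abs _).const_mul _)
    fun z => ?_
  refine (le_abs_self _).trans
    ((cosh_rpow_mul_log_le (y + r * z) m (mem_ball_one hm).2.le).trans ?_)
  rw [one_mul]
  exact exp_abs_affine 3 y r (by norm_num) z

lemma measurable_inner (h a r m : ℝ) :
    Measurable (fun z => ∫ z', cosh (h + a * z + r * z') ^ m ∂γ) := by
  apply StronglyMeasurable.measurable
  apply StronglyMeasurable.integral_prod_right' (f := fun p : ℝ × ℝ => cosh (h + a * p.1 + r * p.2) ^ m)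
  apply Measurable.stronglyMeasurable
  exact (measurable_cosh_rpow m).comp (by fun_prop)

lemma measurable_inner' (h a r m : ℝ) :
    Measurable (fun z => ∫ z', cosh (h + a * z + r * z') ^ m
      * log (cosh (h + a * z + r * z')) ∂γ) := by
  apply StronglyMeasurable.measurable
  apply StronglyMeasurable.integral_prod_right'
    (f := fun p : ℝ × ℝ => cosh (h + a * p.1 + r * p.2) ^ m * log (cosh (h + a * p.1 + r * p.2)))
  apply Measurable.stronglyMeasurable
  exact ((measurable_cosh_rpow m).mul measurable_log_cosh).comp
    (g := fun x => cosh x ^ m * log (cosh x)) (by fun_prop)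

lemma integrable_log_cosh (y r : ℝ) : Integrable (fun z => log (cosh (y + r * z))) γ :=
  integrable_affine measurable_log_cosh 1 1 (by norm_num) (by norm_num) (fun x => by
    rw [abs_of_nonneg (log_cosh_nonneg x)]
    simpa using (log_cosh_le x).trans (cosh_le_exp_abs x)) y r

lemma log_inner_one (y r : ℝ) :
    log (∫ z', cosh (y + r * z') ^ (1 : ℝ) ∂γ) = r ^ 2 / 2 + log (cosh y) := by
  simp_rw [rpow_one]
  rw [integral_cosh, log_mul (exp_pos _).ne' (cosh_pos y).ne', log_exp]

lemma integrable_log_inner_one (h a r : ℝ) :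
    Integrable (fun z => log (∫ z', cosh (h + a * z + r * z') ^ (1 : ℝ) ∂γ)) γ := by
  simp_rw [log_inner_one]
  exact (integrable_const _).add (integrable_log_cosh h a)

lemma hasDerivAt_outer (h a r : ℝ) :
    Integrable (fun z => (∫ z', cosh (h + a * z + r * z') ^ (1 : ℝ)
          * log (cosh (h + a * z + r * z')) ∂γ)
        / ∫ z', cosh (h + a * z + r * z') ^ (1 : ℝ) ∂γ) γ ∧
    HasDerivAt (fun m : ℝ => ∫ z, log (∫ z', cosh (h + a * z + r * z') ^ m ∂γ) ∂γ)
      (∫ z, (∫ z', cosh (h + a * z + r * z') ^ (1 : ℝ) * log (cosh (h + a * z + r * z')) ∂γ)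
        / (∫ z', cosh (h + a * z + r * z') ^ (1 : ℝ) ∂γ) ∂γ) 1 := by
  refine hasDerivAt_integral_of_dominated_loc_of_deriv_le (μ := γ) (x₀ := (1 : ℝ))
    (s := Metric.ball (1 : ℝ) 1)
    (F := fun m z => log (∫ z', cosh (h + a * z + r * z') ^ m ∂γ))
    (F' := fun m z => (∫ z', cosh (h + a * z + r * z') ^ m * log (cosh (h + a * z + r * z')) ∂γ)
        / ∫ z', cosh (h + a * z + r * z') ^ m ∂γ)
    (bound := fun z => (∫ z, exp (3 * |r| * |z|) ∂γ) * exp (3 * |h + a * z|))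
    (Metric.ball_mem_nhds _ one_pos)
    (Eventually.of_forall fun m =>
      (measurable_log.comp (measurable_inner h a r m)).aestronglyMeasurable)
    (integrable_log_inner_one h a r)
    ((measurable_inner' h a r 1).div (measurable_inner h a r 1)).aestronglyMeasurable
    (ae_of_all _ fun z x hx => inner_deriv_bound (h + a * z) r x hx)
    ?_
    (ae_of_all _ fun z x hx =>
      (hasDerivAt_inner (h + a * z) r x hx).log
        (by linarith [integral_cosh_rpow_ge (h + a * z) r x hx]))
  refine Integrable.const_mul ?_ _
  exact integrable_affine (f := fun x => exp (3 * |x|)) (by fun_prop) 1 3 (by norm_num)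
    (by norm_num) (fun x => by rw [abs_of_pos (exp_pos _), one_mul]) h a

lemma abs_tanh_sq_le (x : ℝ) : tanh x ^ 2 ≤ 1 := by
  rw [tanh_eq_sinh_div_cosh, div_pow, cosh_sq, div_le_one (by positivity)]
  linarith

lemma measurable_tanh' : Measurable tanh := by
  have : tanh = fun x => sinh x / cosh x := by ext x; exact tanh_eq_sinh_div_cosh x
  rw [this]; exact measurable_sinh.div measurable_cosh

lemma integrable_tanh_sq (y r : ℝ) : Integrable (fun z => tanh (y + r * z) ^ 2) γ :=
  integrable_affine (f := fun x => tanh x ^ 2) (measurable_tanh'.pow_const 2) 1 0 (by norm_num)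
    (by norm_num) (fun x => by
      rw [abs_of_nonneg (sq_nonneg _)]; simpa using abs_tanh_sq_le x) y r

lemma outer_bound (h a r : ℝ) (hr : 0 ≤ r) :
    (∫ z, (∫ z', cosh (h + a * z + r * z') ^ (1 : ℝ) * log (cosh (h + a * z + r * z')) ∂γ)
        / (∫ z', cosh (h + a * z + r * z') ^ (1 : ℝ) ∂γ) ∂γ)
    ≤ (∫ z, log (cosh (h + a * z)) ∂γ) + r ^ 2 / 2 * (1 + ∫ z, tanh (h + a * z) ^ 2 ∂γ)
      + r ^ 4 / 4 := by
  have i1 := integrable_log_cosh h a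
  have i2 : Integrable (fun z => r ^ 2 / 2 * (1 + tanh (h + a * z) ^ 2)) γ :=
    ((integrable_const (1 : ℝ)).add (integrable_tanh_sq h a)).const_mul _
  have i12 : Integrable (fun z => log (cosh (h + a * z)) + r ^ 2 / 2 * (1 + tanh (h + a * z) ^ 2)) γ :=
    i1.add i2
  have i3 : Integrable (fun z => log (cosh (h + a * z)) + r ^ 2 / 2 * (1 + tanh (h + a * z) ^ 2)
      + r ^ 4 / 4) γ := i12.add (integrable_const _)
  have := integral_mono (hasDerivAt_outer h a r).1 i3 (fun z => by
    have := tilted_bound (h + a * z) r hr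
    simp_rw [rpow_one]
    rw [integral_cosh]
    exact this)
  rw [integral_add i12 (integrable_const _), integral_add i1 i2, integral_const_mul,
    integral_add (integrable_const _) (integrable_tanh_sq h a)] at this
  simpa using this

theorem AT_and_ATplus_hold_for_beta_lt_one
    (β h q : ℝ) (hβ : 0 < β) (hβ1 : β < 1) (hh : 0 < h) (hq : isFixedq β h q) :
    ATcond β h q ∧ ATplus β h q := by
  have hβ2 : β ^ 2 < 1 := by nlinarith
  obtain ⟨hq0, hq1, hqe⟩ := hq
  constructor
  · have hle : ∀ x : ℝ, (cosh x)⁻¹ ^ 4 ≤ 1 := fun x =>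
      pow_le_one₀ (inv_nonneg.2 (cosh_pos x).le) (inv_le_one_of_one_le₀ (one_le_cosh x))
    have i : Integrable (fun z => (cosh (h + β * √q * z))⁻¹ ^ 4) γ :=
      integrable_affine (f := fun x => (cosh x)⁻¹ ^ 4) (measurable_cosh.inv.pow_const 4) 1 0
        (by norm_num) (by norm_num) (fun x => by
          have := inv_nonneg.2 (cosh_pos x).le
          rw [abs_of_nonneg (by positivity)]; simpa using hle x) h (β * √q)
    have h1 := integral_mono i (integrable_const (1 : ℝ)) (fun z => hle _)
    simp only [integral_const, probReal_univ, smul_eq_mul, mul_one] at h1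
    unfold ATcond
    nlinarith [sq_nonneg β]
  · intro q' hqq' hq'1
    have hs : 0 < q' - q := by linarith
    set r := β * √(q' - q) with hrdef
    set a := β * √q with hadef
    have hr : 0 ≤ r := by positivity
    have hr2 : r ^ 2 = β ^ 2 * (q' - q) := by rw [hrdef, mul_pow, sq_sqrt hs.le]
    have hO := (hasDerivAt_outer h a r).2
    have hB := outer_bound h a r hr
    have hL : ∫ z, log (∫ z', cosh (h + a * z + r * z') ^ (1 : ℝ) ∂γ) ∂γ
        = r ^ 2 / 2 + ∫ z, log (cosh (h + a * z)) ∂γ := by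
      simp_rw [log_inner_one]
      rw [integral_add (integrable_const _) (integrable_log_cosh h a)]
      simp
    have hq3 : ∫ z, tanh (h + a * z) ^ 2 ∂γ = q := hqe.symm
    have hinv : HasDerivAt (fun m : ℝ => 1 / m) (-1) 1 := by
      simpa using hasDerivAt_inv (one_ne_zero : (1 : ℝ) ≠ 0)
    have hlin : HasDerivAt (fun m : ℝ => Real.log 2 + β ^ 2 / 4 * (1 - q') ^ 2
        - β ^ 2 / 4 * m * (q' ^ 2 - q ^ 2)) (-(β ^ 2 / 4 * (q' ^ 2 - q ^ 2))) 1 := by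
      have := (((hasDerivAt_id (1 : ℝ)).const_mul (β ^ 2 / 4)).mul_const
        (q' ^ 2 - q ^ 2)).const_sub (Real.log 2 + β ^ 2 / 4 * (1 - q') ^ 2)
      simpa using this
    have hP : HasDerivAt (fun m => Phi β h q m q') _ 1 := hlin.add (hinv.mul hO)
    rw [hP.deriv, hL]
    rw [hq3] at hB
    have hr4 : r ^ 4 = (β ^ 2 * (q' - q)) ^ 2 := by rw [← hr2]; ring
    rw [hr2, hr4] at hB
    rw [hr2]
    have hneg : 0 < β ^ 2 * (q' - q) ^ 2 * (1 - β ^ 2) := by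
      have : 0 < 1 - β ^ 2 := by linarith
      positivity
    nlinarith

end SK
end
end

section
/- For every x ∈ ℝ and every a ≥ 0, with Z' a standard Gaussian and E_{Z'} the expectation over Z', one has E_{Z'} sech³(x + aZ') / E_{Z'} cosh(x + aZ') ≤ E_{Z'} sech⁴(x + aZ'). Consequently, for β, h > 0, q ≤ q' and Z an independent standard Gaussian, β² E_Z [ E_{Z'} sech³(h + β√q Z + β√(q'−q) Z') / E_{Z'} cosh(h + β√q Z + β√(q'−q) Z') ] ≤ β² E_Z E_{Z'} sech⁴(h + β√q Z + β√(q'−q) Z'). -/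
open MeasureTheory ProbabilityTheory Real Filter

noncomputable section

namespace SK

lemma integrable_cosh_aux (x a : ℝ) :
    Integrable (fun z => Real.cosh (x + a * z)) (gaussianReal 0 1) := by
  have h1 := (integrable_exp_mul_gaussianReal (μ := 0) (v := 1) a).const_mul (Real.exp x / 2)
  have h2 := (integrable_exp_mul_gaussianReal (μ := 0) (v := 1) (-a)).const_mul (Real.exp (-x) / 2)
  refine (h1.add h2).congr (ae_of_all _ fun z => ?_)
  have e1 : Real.exp (x + a * z) = Real.exp x * Real.exp (a * z) := Real.exp_add _ _
  have e2 : Real.exp (-(x + a * z)) = Real.exp (-x) * Real.exp (-a * z) := by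
    rw [← Real.exp_add]; ring_nf
  simp only [Pi.add_apply]
  rw [Real.cosh_eq, e1, e2]
  ring

lemma sech_pow_le_one (y : ℝ) (n : ℕ) : (Real.cosh y)⁻¹ ^ n ≤ 1 :=
  pow_le_one₀ (inv_nonneg.2 (Real.cosh_pos y).le) (inv_le_one_of_one_le₀ (Real.one_le_cosh y))

lemma sech_pow_nonneg (y : ℝ) (n : ℕ) : 0 ≤ (Real.cosh y)⁻¹ ^ n :=
  pow_nonneg (inv_nonneg.2 (Real.cosh_pos y).le) n

lemma integrable_sech_aux (x a : ℝ) (n : ℕ) :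
    Integrable (fun z => (Real.cosh (x + a * z))⁻¹ ^ n) (gaussianReal 0 1) := by
  refine Integrable.of_bound (C := 1) ?_ (ae_of_all _ fun z => ?_)
  · exact (by fun_prop : Measurable fun z => (Real.cosh (x + a * z))⁻¹ ^ n).aestronglyMeasurable
  · rw [Real.norm_of_nonneg (sech_pow_nonneg _ n)]
    exact sech_pow_le_one _ n

lemma pointwise_aux (c M : ℝ) (hc : 0 < c) (hM : 0 < M) :
    c⁻¹ ^ 3 + M⁻¹ ^ 4 * M ≤ M * c⁻¹ ^ 4 + M⁻¹ ^ 4 * c := by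
  have key : 0 ≤ (c⁻¹ ^ 4 - M⁻¹ ^ 4) * (M - c) := by
    rcases le_total c M with h | h
    · exact mul_nonneg (sub_nonneg.2 (by gcongr)) (sub_nonneg.2 h)
    · exact mul_nonneg_of_nonpos_of_nonpos (sub_nonpos.2 (by gcongr)) (sub_nonpos.2 h)
  have e : c⁻¹ ^ 4 * c = c⁻¹ ^ 3 := by field_simp
  nlinarith

lemma cosh_integral_pos (x a : ℝ) : 0 < ∫ z, Real.cosh (x + a * z) ∂(gaussianReal 0 1) := by
  have h : ∫ _z : ℝ, (1 : ℝ) ∂(gaussianReal 0 1) ≤ ∫ z, Real.cosh (x + a * z) ∂(gaussianReal 0 1) :=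
    integral_mono (integrable_const _) (integrable_cosh_aux x a) fun z => Real.one_le_cosh _
  simp only [integral_const, probReal_univ, smul_eq_mul, mul_one] at h
  linarith

lemma first_part (x a : ℝ) :
    (∫ z', (Real.cosh (x + a * z'))⁻¹ ^ 3 ∂(gaussianReal 0 1))
          / (∫ z', Real.cosh (x + a * z') ∂(gaussianReal 0 1))
        ≤ ∫ z', (Real.cosh (x + a * z'))⁻¹ ^ 4 ∂(gaussianReal 0 1) := by
  have hM := cosh_integral_pos x a
  rw [div_le_iff₀ hM]
  set M := ∫ z', Real.cosh (x + a * z') ∂(gaussianReal 0 1) with hMdef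
  have h := integral_mono (μ := gaussianReal 0 1)
    ((integrable_sech_aux x a 3).add (integrable_const (M⁻¹ ^ 4 * M)))
    (((integrable_sech_aux x a 4).const_mul M).add
      ((integrable_cosh_aux x a).const_mul (M⁻¹ ^ 4)))
    (fun z => pointwise_aux (Real.cosh (x + a * z)) M (Real.cosh_pos _) hM)
  simp only [Pi.add_apply] at h
  rw [integral_add (integrable_sech_aux x a 3) (integrable_const _),
    integral_add ((integrable_sech_aux x a 4).const_mul M)
      ((integrable_cosh_aux x a).const_mul (M⁻¹ ^ 4)),
    integral_const_mul, integral_const_mul, integral_const_mul, ← hMdef] at h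
  simp only [integral_const, probReal_univ, smul_eq_mul, one_mul] at h
  linarith

/-- For every `x ∈ ℝ` and `a ≥ 0`, with `Z'` a standard Gaussian,
`E_{Z'} sech³(x + aZ') / E_{Z'} cosh(x + aZ') ≤ E_{Z'} sech⁴(x + aZ')`; consequently, for
`β, h > 0` and `q ≤ q'`,
`β² E_Z [E_{Z'} sech³(h + β√q Z + β√(q'-q) Z') / E_{Z'} cosh(h + β√q Z + β√(q'-q) Z')]`
`≤ β² E_Z E_{Z'} sech⁴(h + β√q Z + β√(q'-q) Z')`. -/
theorem sech_cubed_over_cosh_le_sech_fourth :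
    (∀ x a : ℝ, 0 ≤ a →
      (∫ z', (Real.cosh (x + a * z'))⁻¹ ^ 3 ∂(gaussianReal 0 1))
          / (∫ z', Real.cosh (x + a * z') ∂(gaussianReal 0 1))
        ≤ ∫ z', (Real.cosh (x + a * z'))⁻¹ ^ 4 ∂(gaussianReal 0 1)) ∧
    (∀ β h q q' : ℝ, 0 < β → 0 < h → q ≤ q' →
      β ^ 2 * ∫ z,
          (∫ z', (Real.cosh (h + β * Real.sqrt q * z + β * Real.sqrt (q' - q) * z'))⁻¹ ^ 3
              ∂(gaussianReal 0 1))
            / (∫ z', Real.cosh (h + β * Real.sqrt q * z + β * Real.sqrt (q' - q) * z')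
              ∂(gaussianReal 0 1)) ∂(gaussianReal 0 1)
        ≤ β ^ 2 * ∫ z, ∫ z',
            (Real.cosh (h + β * Real.sqrt q * z + β * Real.sqrt (q' - q) * z'))⁻¹ ^ 4
              ∂(gaussianReal 0 1) ∂(gaussianReal 0 1)) := by
  refine ⟨fun x a _ => first_part x a, fun β h q q' _ _ _ => ?_⟩
  refine mul_le_mul_of_nonneg_left ?_ (sq_nonneg β)
  refine integral_mono_of_nonneg (ae_of_all _ fun z => ?_) ?_ (ae_of_all _ fun z => ?_)
  · exact div_nonneg (integral_nonneg fun z' => sech_pow_nonneg _ 3) (cosh_integral_pos _ _).le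
  · refine Integrable.of_bound (C := 1) ?_ (ae_of_all _ fun z => ?_)
    · have hm : Measurable (fun p : ℝ × ℝ =>
          (Real.cosh (h + β * Real.sqrt q * p.1 + β * Real.sqrt (q' - q) * p.2))⁻¹ ^ 4) := by
        fun_prop
      exact (hm.stronglyMeasurable.integral_prod_right
        (ν := gaussianReal 0 1)).aestronglyMeasurable
    · rw [Real.norm_of_nonneg (integral_nonneg fun z' => sech_pow_nonneg _ 4)]
      have := integral_mono (μ := gaussianReal 0 1)
        (integrable_sech_aux (h + β * Real.sqrt q * z) (β * Real.sqrt (q' - q)) 4)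
        (integrable_const 1) (fun z' => sech_pow_le_one _ 4)
      simpa using this
  · exact first_part _ _

end SK
end
end

section
/- Let β > 0, h > 0 satisfy the AT condition, let q ∈ (0,1) solve q = E tanh²(h + β√q Z) and set q₄ = E tanh⁴(h + β√q Z). Then q > q₄, 1 − β²(1 − 2q + q₄) > 0, 1 − β²(1 − 4q + 3q₄) > 0, and 2β²q − 2β⁴ q (1 − 4q + 3q₄) − (q − q₄)^{−1} (1 − β²(1 − 4q + 3q₄))² < 0. -/
open MeasureTheory ProbabilityTheory Real Filter

noncomputable section

namespace SK

/-- `q₄ = E tanh⁴(h + β √q Z)`. -/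
def qFour (β h q : ℝ) : ℝ :=
  ∫ z, Real.tanh (h + β * Real.sqrt q * z) ^ 4 ∂(gaussianReal 0 1)

/-- Under the AT condition, with `q₄ = E tanh⁴(h + β√q Z)`:
`q > q₄`, `1 - β²(1-2q+q₄) > 0`, `1 - β²(1-4q+3q₄) > 0`, and
`2β²q - 2β⁴q(1-4q+3q₄) - (q-q₄)⁻¹ (1-β²(1-4q+3q₄))² < 0`. -/
theorem Hessian_concavity_inequalities
    (β h q : ℝ) (hβ : 0 < β) (hh : 0 < h) (hq : isFixedq β h q) (hAT : ATcond β h q) :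
    qFour β h q < q ∧
    0 < 1 - β ^ 2 * (1 - 2 * q + qFour β h q) ∧
    0 < 1 - β ^ 2 * (1 - 4 * q + 3 * qFour β h q) ∧
    2 * β ^ 2 * q - 2 * β ^ 4 * q * (1 - 4 * q + 3 * qFour β h q)
        - (q - qFour β h q)⁻¹ * (1 - β ^ 2 * (1 - 4 * q + 3 * qFour β h q)) ^ 2
      < 0 := by
  obtain ⟨hq0, hq1, hqe⟩ := hq
  unfold ATcond at hAT
  unfold qtanh at hqe
  unfold qFour
  have hcont : Continuous (fun z : ℝ => Real.tanh (h + β * Real.sqrt q * z)) := by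
    have : (fun z : ℝ => Real.tanh (h + β * Real.sqrt q * z)) =
        fun z => Real.sinh (h + β * Real.sqrt q * z) / Real.cosh (h + β * Real.sqrt q * z) := by
      funext z; exact Real.tanh_eq_sinh_div_cosh _
    rw [this]
    exact Continuous.div (by fun_prop) (by fun_prop) (fun z => (Real.cosh_pos _).ne')
  have hlt : ∀ x : ℝ, Real.tanh x ^ 2 < 1 := by
    intro x
    have := Real.cosh_sq x
    have hc := Real.cosh_pos x
    rw [Real.tanh_eq_sinh_div_cosh, div_pow, div_lt_one (by positivity)]
    linarith
  have hsech : ∀ x : ℝ, (Real.cosh x)⁻¹ ^ 4 = 1 - 2 * Real.tanh x ^ 2 + Real.tanh x ^ 4 := by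
    intro x
    have h1 := Real.cosh_sq x
    have hc := (Real.cosh_pos x).ne'
    have h2 : Real.sinh x ^ 2 = Real.cosh x ^ 2 - 1 := by linarith
    have h3 : (Real.cosh x)⁻¹ ^ 2 = 1 - Real.tanh x ^ 2 := by
      rw [Real.tanh_eq_sinh_div_cosh, div_pow, h2]
      field_simp
      ring
    calc (Real.cosh x)⁻¹ ^ 4 = ((Real.cosh x)⁻¹ ^ 2) ^ 2 := by ring
      _ = _ := by rw [h3]; ring
  have hint2 : Integrable (fun z : ℝ => Real.tanh (h + β * Real.sqrt q * z) ^ 2)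
      (gaussianReal 0 1) := by
    refine Integrable.of_bound (hcont.pow 2).aestronglyMeasurable 1 (ae_of_all _ fun z => ?_)
    rw [Real.norm_eq_abs, abs_of_nonneg (by positivity)]
    exact (hlt _).le
  have hint4 : Integrable (fun z : ℝ => Real.tanh (h + β * Real.sqrt q * z) ^ 4)
      (gaussianReal 0 1) := by
    refine Integrable.of_bound (hcont.pow 4).aestronglyMeasurable 1 (ae_of_all _ fun z => ?_)
    rw [Real.norm_eq_abs, abs_of_nonneg (by positivity)]
    nlinarith [hlt (h + β * Real.sqrt q * z), sq_nonneg (Real.tanh (h + β * Real.sqrt q * z))]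
  have hAT' : ∫ z, (Real.cosh (h + β * Real.sqrt q * z))⁻¹ ^ 4 ∂(gaussianReal 0 1)
      = 1 - 2 * q + ∫ z, Real.tanh (h + β * Real.sqrt q * z) ^ 4 ∂(gaussianReal 0 1) := by
    simp_rw [hsech]
    have hi : Integrable (fun z : ℝ => 1 - 2 * Real.tanh (h + β * Real.sqrt q * z) ^ 2)
        (gaussianReal 0 1) := (integrable_const 1).sub (hint2.const_mul 2)
    rw [integral_add hi hint4,
      integral_sub (integrable_const _) (hint2.const_mul 2), integral_const_mul, ← hqe]
    simp
  rw [hAT'] at hAT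
  have hle : ∀ z : ℝ, 0 ≤ Real.tanh (h + β * Real.sqrt q * z) ^ 2 -
      Real.tanh (h + β * Real.sqrt q * z) ^ 4 := fun z => by
    nlinarith [hlt (h + β * Real.sqrt q * z), sq_nonneg (Real.tanh (h + β * Real.sqrt q * z))]
  have hd : ∫ z, (Real.tanh (h + β * Real.sqrt q * z) ^ 2 -
      Real.tanh (h + β * Real.sqrt q * z) ^ 4) ∂(gaussianReal 0 1)
      = q - ∫ z, Real.tanh (h + β * Real.sqrt q * z) ^ 4 ∂(gaussianReal 0 1) := by
    rw [integral_sub hint2 hint4, ← hqe]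
  have hpos : 0 < q - ∫ z, Real.tanh (h + β * Real.sqrt q * z) ^ 4 ∂(gaussianReal 0 1) := by
    rw [← hd]
    refine lt_of_le_of_ne (integral_nonneg hle) (fun h0 => ?_)
    have hz := (integral_eq_zero_iff_of_nonneg hle (hint2.sub hint4)).1 h0.symm
    have hz2 : (fun z : ℝ => Real.tanh (h + β * Real.sqrt q * z) ^ 2)
        =ᵐ[gaussianReal 0 1] fun _ => (0 : ℝ) := by
      filter_upwards [hz] with z hz
      have hz' : Real.tanh (h + β * Real.sqrt q * z) ^ 2 -
        Real.tanh (h + β * Real.sqrt q * z) ^ 4 = 0 := hz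
      have h1 : Real.tanh (h + β * Real.sqrt q * z) ^ 2 *
        (1 - Real.tanh (h + β * Real.sqrt q * z) ^ 2) = 0 := by linear_combination hz'
      rcases mul_eq_zero.1 h1 with h2 | h2
      · exact h2
      · exact absurd h2 (by linarith [hlt (h + β * Real.sqrt q * z)])
    rw [integral_congr_ae hz2] at hqe
    simp at hqe
    linarith
  generalize (∫ z, Real.tanh (h + β * Real.sqrt q * z) ^ 4 ∂(gaussianReal 0 1)) = r at *
  have hb : 0 < β ^ 2 := by positivity
  have hbd : 0 < β ^ 2 * (q - r) := mul_pos hb hpos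
  have hB : 0 < 1 - β ^ 2 * (1 - 4 * q + 3 * r) := by nlinarith
  refine ⟨by linarith, by linarith, hB, ?_⟩
  have hkey : 2 * β ^ 2 * q - (q - r)⁻¹ * (1 - β ^ 2 * (1 - 4 * q + 3 * r)) < 0 := by
    rw [sub_neg, inv_mul_eq_div, lt_div_iff₀ hpos]
    nlinarith [mul_pos hbd (sub_pos.2 hq1)]
  nlinarith [mul_neg_of_neg_of_pos hkey hB]

end SK
end
end
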